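/- For every integer n ≥ 2, the abelian group Z_n × Z_n admits no oriented regular representation (ORR) of valency two; that is, there is no subset S ⊆ Z_n × Z_n with |S| = 2, 0 ∉ S and S ∩ (−S) = ∅ such that the full automorphism group of the Cayley digraph Cay(Z_n × Z_n, S) is exactly the right regular representation of Z_n × Z_n. -/

import Mathlib

/-- A generating pair of `R × R` is a basis, so its two members are exchanged by a linear
automorphism. -/
theorem exists_linearEquiv_swap_of_span_pair_eq_top {R : Type*} [CommRing R] {a b : R × R}
    (h : Submodule.span R {a, b} = ⊤) :
    ∃ e : (R × R) ≃ₗ[R] (R × R), e a = b ∧ e b = a := by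
  let f : (R × R) →ₗ[R] (R × R) :=
    (LinearMap.toSpanSingleton R _ a).coprod (LinearMap.toSpanSingleton R _ b)
  have hsurj : Function.Surjective f := fun x => by
    obtain ⟨s, t, hst⟩ :=
      Submodule.mem_span_pair.1 (h ▸ Submodule.mem_top : x ∈ Submodule.span R {a, b})
    exact ⟨(s, t), by simp [f, hst]⟩
  let F := LinearEquiv.ofBijective f
    ⟨OrzechProperty.injective_of_surjective_endomorphism f hsurj, hsurj⟩
  have hF : ∀ x, F x = f x := fun _ => rfl
  have ha : F (1, 0) = a := by simp [hF, f]
  have hb : F (0, 1) = b := by simp [hF, f]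
  refine ⟨F.symm.trans ((LinearEquiv.prodComm R R R).trans F), ?_, ?_⟩
  · simp [← ha, ← hb]
  · simp [← ha, ← hb]

/-- Translating a subgroup by one of its elements, and fixing everything outside it, preserves every
Cayley digraph whose connection set lies in the subgroup. -/
theorem exists_perm_translate_addSubgroup {G : Type*} [AddCommGroup G] (H : AddSubgroup G)
    {S : Set G} (hS : S ⊆ H) {a : G} (ha : a ∈ H) :
    ∃ σ : Equiv.Perm G, (∀ x y, σ y - σ x ∈ S ↔ y - x ∈ S) ∧ σ 0 = a ∧ ∀ x ∉ H, σ x = x := by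
  classical
  have hadd : ∀ x, x + a ∈ H ↔ x ∈ H := fun x => H.add_mem_cancel_right ha
  have hsub : ∀ x, x - a ∈ H ↔ x ∈ H := fun x => by rw [← hadd (x - a), sub_add_cancel]
  let σ : Equiv.Perm G :=
    { toFun := fun x => if x ∈ H then x + a else x
      invFun := fun x => if x ∈ H then x - a else x
      left_inv := fun x => by by_cases hx : x ∈ H <;> simp [hx, hadd]
      right_inv := fun x => by by_cases hx : x ∈ H <;> simp [hx, hsub] }
  have hσ : ∀ x, σ x = if x ∈ H then x + a else x := fun _ => rfl
  refine ⟨σ, fun x y => ?_, by simp [hσ], fun x hx => by simp [hσ, hx]⟩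
  have hmem : ∀ {u v : G}, v - u ∈ S → (v ∈ H ↔ u ∈ H) := fun {u v} huv => by
    rw [← H.add_mem_cancel_left (hS huv) (y := u), sub_add_cancel]
  by_cases hx : x ∈ H <;> by_cases hy : y ∈ H
  · simp [hσ, hx, hy]
  · simp only [hσ, hx, hy, if_true, if_false]
    exact ⟨fun h => absurd ((hmem h).2 ((hadd x).2 hx)) hy, fun h => absurd ((hmem h).2 hx) hy⟩
  · simp only [hσ, hx, hy, if_true, if_false]
    exact ⟨fun h => absurd ((hmem h).1 ((hadd y).2 hy)) hx, fun h => absurd ((hmem h).1 hy) hx⟩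
  · simp [hσ, hx, hy]


/-- For every `n ≥ 2`, the abelian group `Z_n × Z_n` admits no ORR of valency
two: there is no subset `S` with `|S| = 2`, `0 ∉ S` and `S ∩ (-S) = ∅` such that
the full automorphism group of the Cayley digraph `Cay(Z_n × Z_n, S)` (with arc
set `{(g, s + g) : g ∈ Z_n × Z_n, s ∈ S}`) consists exactly of the right
translations. -/
theorem znzn_no_orr_valency_two (n : ℕ) (hn : 2 ≤ n) :
    ¬ ∃ S : Set (ZMod n × ZMod n),
      S.ncard = 2 ∧ (0 : ZMod n × ZMod n) ∉ S ∧ S ∩ (-S) = ∅ ∧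
      ∀ σ : Equiv.Perm (ZMod n × ZMod n),
        (∀ x y : ZMod n × ZMod n, σ y - σ x ∈ S ↔ y - x ∈ S) ↔
          ∃ h : ZMod n × ZMod n, σ = Equiv.addRight h := by
  rintro ⟨S, hcard, h0, -, hS⟩
  obtain ⟨a, b, hab, rfl⟩ := Set.ncard_eq_two.1 hcard
  by_cases hspan : Submodule.span (ZMod n) {a, b} = ⊤
  · obtain ⟨e, hea, heb⟩ := exists_linearEquiv_swap_of_span_pair_eq_top hspan
    have he : ∀ z, e z ∈ ({a, b} : Set _) ↔ z ∈ ({a, b} : Set _) := fun z => by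
      have h₁ : e z = a ↔ z = b := by rw [← heb, e.injective.eq_iff]
      have h₂ : e z = b ↔ z = a := by rw [← hea, e.injective.eq_iff]
      simp only [Set.mem_insert_iff, Set.mem_singleton_iff, h₁, h₂, or_comm]
    obtain ⟨h, hh⟩ := (hS e.toEquiv).1 fun x y => by simpa using he (y - x)
    have hz : ∀ x, e x = x + h := fun x => congrArg (fun σ : Equiv.Perm _ => σ x) hh
    have hh0 : h = 0 := by simpa using (hz 0).symm
    exact hab (by simpa [hea, hh0] using (hz a).symm)
  · obtain ⟨g, hg⟩ : ∃ g, g ∉ Submodule.span (ZMod n) {a, b} := by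
      simpa [Submodule.eq_top_iff'] using hspan
    obtain ⟨σ, hσ, hσ0, hσg⟩ := exists_perm_translate_addSubgroup
      (Submodule.span (ZMod n) {a, b}).toAddSubgroup Submodule.subset_span
      (Submodule.subset_span (Set.mem_insert a {b}))
    obtain ⟨h, rfl⟩ := (hS σ).1 hσ
    have hha : h = a := by simpa using hσ0
    have hh0 : h = 0 := by simpa using hσg g hg
    exact h0 (by simp [← hh0, hha])
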